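/- arXiv:2104.14618 — 2 statements merged into one kernel-verified Lean document; each statement's English description precedes it below -/
import Mathlib

section
/- Let N be a natural number, a : Fin N → ℝ, and f : ℝ. Define the random-phase multi-harmonic signal D(t, θ) = Σ_{k=0}^{N−1} a(k) · cos(2π(k+1) f t + θ(k)) for θ : Fin N → ℝ. Let μ be the product measure on (Fin N → ℝ) whose k-th factor is the uniform probability measure on [−π, π] (i.e., (2π)^{-1} times Lebesgue measure restricted to [−π, π]). Then for all t₁, t₂ ∈ ℝ, the autocorrelation satisfies ∫ D(t₁, θ) · D(t₂, θ) dμ(θ) = Σ_{k=0}^{N−1} (a(k)² / 2) · cos(2π(k+1) f (t₁ − t₂)). -/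
open Real MeasureTheory

noncomputable def unifPhase : Measure ℝ :=
  (ENNReal.ofReal (2 * π))⁻¹ • volume.restrict (Set.Icc (-π) π)

instance unifPhase_prob : IsProbabilityMeasure unifPhase := by
  constructor
  have h : π - -π = 2 * π := by ring
  have hp : (0:ℝ) < 2 * π := by positivity
  simp only [unifPhase, Measure.smul_apply, Measure.restrict_apply_univ, Real.volume_Icc, h,
    smul_eq_mul]
  exact ENNReal.inv_mul_cancel (by simpa using hp) ENNReal.ofReal_ne_top

lemma unifPhase_integral (g : ℝ → ℝ) :
    ∫ x, g x ∂unifPhase = (2 * π)⁻¹ * ∫ x in (-π)..π, g x := by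
  have hp : (0:ℝ) < 2 * π := by positivity
  rw [unifPhase, integral_smul_measure, integral_Icc_eq_integral_Ioc,
    intervalIntegral.integral_of_le (by linarith [Real.pi_pos]), ENNReal.toReal_inv,
    ENNReal.toReal_ofReal hp.le, smul_eq_mul]

lemma unifPhase_cos (c : ℝ) : ∫ x, Real.cos (c + x) ∂unifPhase = 0 := by
  rw [unifPhase_integral, intervalIntegral.integral_comp_add_left (fun x => Real.cos x),
    integral_cos]
  simp [Real.sin_add]

lemma unifPhase_cos_mul (c d : ℝ) :
    ∫ x, Real.cos (c + x) * Real.cos (d + x) ∂unifPhase = Real.cos (c - d) / 2 := by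
  have h : ∀ x, Real.cos (c + x) * Real.cos (d + x)
      = Real.cos (c - d) / 2 + (1 / 2) * Real.cos (c + d + 2 * x) := by
    intro x
    have h1 : c - d = (c + x) - (d + x) := by ring
    have h2 : c + d + 2 * x = (c + x) + (d + x) := by ring
    rw [h1, h2, Real.cos_sub, Real.cos_add (c + x)]
    ring
  have h3 : ∫ x in (-π)..π, Real.cos (c + d + 2 * x) = 0 := by
    rw [intervalIntegral.integral_comp_add_mul (fun x => Real.cos x) two_ne_zero, integral_cos]
    simp [Real.sin_add]
  simp_rw [h]
  rw [unifPhase_integral, intervalIntegral.integral_add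
    (Continuous.intervalIntegrable (by fun_prop) _ _)
    (Continuous.intervalIntegrable (by fun_prop) _ _), intervalIntegral.integral_const_mul, h3,
    intervalIntegral.integral_const, smul_eq_mul]
  field_simp
  ring

lemma pair_integral {N : ℕ} (c d : Fin N → ℝ) (i j : Fin N) :
    ∫ θ : Fin N → ℝ, Real.cos (c i + θ i) * Real.cos (d j + θ j)
      ∂(Measure.pi fun _ : Fin N => unifPhase) =
      if i = j then Real.cos (c i - d i) / 2 else 0 := by
  split_ifs with h
  · subst h
    rw [integral_comp_eval (μ := fun _ : Fin N => unifPhase) (i := i)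
      (f := fun x => Real.cos (c i + x) * Real.cos (d i + x))
      (Continuous.aestronglyMeasurable (by fun_prop)), unifPhase_cos_mul]
  · have hi := (ProbabilityTheory.iIndepFun_pi (μ := fun _ : Fin N => unifPhase)
      (X := fun _ x => x) (fun _ => aemeasurable_id')).indepFun h
    have h2 := hi.comp (φ := fun x => Real.cos (c i + x)) (ψ := fun x => Real.cos (d j + x))
      (by fun_prop) (by fun_prop)
    have h3 := h2.integral_fun_mul_eq_mul_integral
      (Continuous.aestronglyMeasurable (by simp only [Function.comp_def]; fun_prop))
      (Continuous.aestronglyMeasurable (by simp only [Function.comp_def]; fun_prop))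
    simp only [Function.comp_def] at h3
    rw [h3, integral_comp_eval (μ := fun _ : Fin N => unifPhase) (i := i)
      (f := fun x => Real.cos (c i + x))
      (Continuous.aestronglyMeasurable (by fun_prop)), unifPhase_cos, zero_mul]

theorem autocorrelation_random_phase_multiharmonic
    (N : ℕ) (a : Fin N → ℝ) (f : ℝ)
    (D : ℝ → (Fin N → ℝ) → ℝ)
    (hD : ∀ t θ, D t θ = ∑ k : Fin N, a k * Real.cos (2 * π * ((k : ℝ) + 1) * f * t + θ k))
    (μ : Measure (Fin N → ℝ))
    (hμ : μ = Measure.pi fun _ : Fin N =>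
      (ENNReal.ofReal (2 * π))⁻¹ • volume.restrict (Set.Icc (-π) π))
    (t₁ t₂ : ℝ) :
    ∫ θ, D t₁ θ * D t₂ θ ∂μ =
      ∑ k : Fin N, (a k ^ 2 / 2) * Real.cos (2 * π * ((k : ℝ) + 1) * f * (t₁ - t₂)) := by
  change μ = Measure.pi fun _ : Fin N => unifPhase at hμ
  subst hμ
  simp_rw [hD, Finset.sum_mul_sum]
  have hint : ∀ i j : Fin N, Integrable (fun θ : Fin N → ℝ =>
      a i * Real.cos (2 * π * ((i : ℝ) + 1) * f * t₁ + θ i) *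
      (a j * Real.cos (2 * π * ((j : ℝ) + 1) * f * t₂ + θ j)))
      (Measure.pi fun _ : Fin N => unifPhase) := by
    intro i j
    refine Integrable.of_bound (Continuous.aestronglyMeasurable (by fun_prop)) (|a i| * |a j|)
      (Filter.Eventually.of_forall fun θ => ?_)
    rw [Real.norm_eq_abs, abs_mul, abs_mul, abs_mul]
    gcongr
    · exact mul_le_of_le_one_right (abs_nonneg _) (Real.abs_cos_le_one _)
    · exact mul_le_of_le_one_right (abs_nonneg _) (Real.abs_cos_le_one _)
  rw [integral_finsetSum _ fun i _ => integrable_finsetSum _ fun j _ => hint i j]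
  refine Finset.sum_congr rfl fun i _ => ?_
  rw [integral_finsetSum _ fun j _ => hint i j]
  have key : ∀ j : Fin N, ∫ θ : Fin N → ℝ,
      a i * Real.cos (2 * π * ((i : ℝ) + 1) * f * t₁ + θ i) *
      (a j * Real.cos (2 * π * ((j : ℝ) + 1) * f * t₂ + θ j))
      ∂(Measure.pi fun _ : Fin N => unifPhase) =
      if i = j then (a i ^ 2 / 2) * Real.cos (2 * π * ((i : ℝ) + 1) * f * (t₁ - t₂)) else 0 := by
    intro j
    simp_rw [mul_mul_mul_comm (a i)]
    rw [integral_const_mul, pair_integral (fun i : Fin N => 2 * π * ((i : ℝ) + 1) * f * t₁)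
      (fun j : Fin N => 2 * π * ((j : ℝ) + 1) * f * t₂) i j]
    split_ifs with h
    · subst h
      simp only [← mul_sub]
      ring
    · simp
  simp [key]
end

section
/- Let n be a natural number and A, Q₁, Q₂, R₁, R₂ be n×n real matrices such that A is invertible, Q₁ and Q₂ are orthogonal (Qᵢᵀ · Qᵢ = 1), R₁ and R₂ are upper triangular (entries below the diagonal are zero) with every diagonal entry of R₁ and of R₂ strictly positive, and A = Q₁ · R₁ = Q₂ · R₂. Then Q₁ = Q₂ and R₁ = R₂. -/
open Matrix

theorem qr_decomposition_unique_positive_diagonal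
    (n : ℕ) (A Q₁ Q₂ R₁ R₂ : Matrix (Fin n) (Fin n) ℝ)
    (hA : IsUnit A)
    (hQ₁ : Q₁ᵀ * Q₁ = 1) (hQ₂ : Q₂ᵀ * Q₂ = 1)
    (hR₁ : ∀ i j : Fin n, j < i → R₁ i j = 0)
    (hR₂ : ∀ i j : Fin n, j < i → R₂ i j = 0)
    (hR₁pos : ∀ i : Fin n, 0 < R₁ i i)
    (hR₂pos : ∀ i : Fin n, 0 < R₂ i i)
    (h₁ : A = Q₁ * R₁) (h₂ : A = Q₂ * R₂) :
    Q₁ = Q₂ ∧ R₁ = R₂ := by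
  have hR : R₁ᵀ * R₁ = R₂ᵀ * R₂ := by
    have e1 : Aᵀ * A = R₁ᵀ * R₁ := by
      rw [h₁, Matrix.transpose_mul, Matrix.mul_assoc, ← Matrix.mul_assoc Q₁ᵀ, hQ₁, Matrix.one_mul]
    have e2 : Aᵀ * A = R₂ᵀ * R₂ := by
      rw [h₂, Matrix.transpose_mul, Matrix.mul_assoc, ← Matrix.mul_assoc Q₂ᵀ, hQ₂, Matrix.one_mul]
    rw [← e1, e2]
  have key : ∀ i : Fin n, ∀ j : Fin n, R₁ i j = R₂ i j := by
    intro i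
    induction i using WellFoundedLT.induction with
    | ind i ih =>
      have row : ∀ j, R₁ i i * R₁ i j = R₂ i i * R₂ i j := by
        intro j
        have h := congrFun (congrFun hR i) j
        simp only [Matrix.mul_apply, Matrix.transpose_apply] at h
        rw [← sub_eq_zero, ← Finset.sum_sub_distrib, Finset.sum_eq_single i] at h
        · exact sub_eq_zero.mp h
        · intro k _ hk
          rcases lt_or_gt_of_ne hk with hk | hk
          · rw [ih k hk i, ih k hk j, sub_self]
          · rw [hR₁ k i hk, hR₂ k i hk]; ring
        · intro hi
          exact absurd (Finset.mem_univ i) hi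
      have d : R₁ i i = R₂ i i :=
        (mul_self_inj (hR₁pos i).le (hR₂pos i).le).mp (row i)
      intro j
      have h := row j
      rw [d] at h
      exact mul_left_cancel₀ (hR₂pos i).ne' h
  have hRR : R₁ = R₂ := by
    ext i j
    exact key i j
  refine ⟨?_, hRR⟩
  subst hRR
  have hu : IsUnit R₁ := by
    have e : R₁ = Q₁ᵀ * A := by rw [h₁, ← Matrix.mul_assoc, hQ₁, Matrix.one_mul]
    rw [e]
    exact (IsUnit.of_mul_eq_one _ hQ₁).mul hA
  exact hu.mul_right_cancel (h₁.symm.trans h₂)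
end
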